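/- arXiv:1503.08702 — 3 statements merged into one kernel-verified Lean document; each statement's English description precedes it below -/
import Mathlib

section
/- Martingale arcsinh (Prokhorov) inequality. Let (F_μ)_{μ=0}^d be a filtration of σ-algebras on a probability space and (X_μ)_{μ=0}^d a complex-valued martingale with respect to it. Suppose there are deterministic constants M, s_0, s_1, …, s_{d−1} > 0 such that almost surely |X_{μ+1} − X_μ| ≤ M for all 0 ≤ μ < d, and E[|X_{μ+1} − X_μ|² | F_μ] ≤ s_μ for all 0 ≤ μ < d. Set S := Σ_{μ=0}^{d−1} s_μ. Then for every ξ > 0: P( |X_d − X_0| ≥ ξ ) ≤ 4·exp( −(ξ/(2√2·M))·arcsinh( M·ξ/(2√2·S) ) ). -/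
open MeasureTheory

noncomputable section

lemma convexOn_sinh_Ici : ConvexOn ℝ (Set.Ici 0) Real.sinh := by
  refine convexOn_of_deriv2_nonneg (convex_Ici 0) Real.continuous_sinh.continuousOn
    Real.differentiable_sinh.differentiableOn ?_ ?_
  · rw [Real.deriv_sinh]
    exact Real.differentiable_cosh.differentiableOn
  · intro x hx
    rw [interior_Ici, Set.mem_Ioi] at hx
    simpa [Real.sinh_nonneg_iff] using hx.le

lemma mul_sinh_le_mul_sinh {y L : ℝ} (hy : 0 ≤ y) (hyL : y ≤ L) :
    L * Real.sinh y ≤ y * Real.sinh L := by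
  rcases (hy.trans hyL).eq_or_lt with h | hL
  · have : y = 0 := by linarith
    simp [this, ← h]
  have h := convexOn_sinh_Ici.2 (Set.mem_Ici.2 le_rfl) (Set.mem_Ici.2 hL.le)
    (sub_nonneg.2 ((div_le_one hL).2 hyL)) (div_nonneg hy hL.le) (sub_add_cancel 1 (y / L))
  simp only [smul_eq_mul, mul_zero, zero_add, Real.sinh_zero, div_mul_cancel₀ _ hL.ne'] at h
  calc L * Real.sinh y ≤ L * (y / L * Real.sinh L) := by gcongr
    _ = y * Real.sinh L := by field_simp

lemma exp_le_one_add_add_mul_sinh (x : ℝ) : Real.exp x ≤ 1 + x + x * Real.sinh x := by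
  set f : ℝ → ℝ := fun y => 1 + y + y * Real.sinh y - Real.exp y with hf
  have hderiv (y : ℝ) : HasDerivAt f (1 + (y - 1) * Real.cosh y) y := by
    convert! (((hasDerivAt_id y).const_add 1).add
      ((hasDerivAt_id y).mul (Real.hasDerivAt_sinh y))).sub (Real.hasDerivAt_exp y) using 1
    rw [← Real.cosh_add_sinh y]
    simp only [id]
    ring
  have hdiff : Differentiable ℝ f := fun y => (hderiv y).differentiableAt
  have h0 : f 0 = 0 := by simp [hf]
  suffices 0 ≤ f x by simp only [hf] at this; linarith
  rcases le_total 0 x with hx | hx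
  · rw [← h0]
    refine monotoneOn_of_deriv_nonneg (convex_Ici 0) hdiff.continuous.continuousOn
      hdiff.differentiableOn (fun y hy => ?_) (Set.mem_Ici.2 le_rfl) hx hx
    rw [interior_Ici, Set.mem_Ioi] at hy
    rw [(hderiv y).deriv]
    rcases le_total 1 y with h1 | h1
    · have := mul_nonneg (sub_nonneg.2 h1) (Real.cosh_pos y).le
      linarith
    · have hcosh : Real.cosh y ≤ Real.exp y := by
        rw [← Real.cosh_add_sinh y]
        linarith [Real.sinh_nonneg_iff.2 hy.le]
      have hle : (1 - y) * Real.cosh y ≤ Real.exp (-y) * Real.exp y :=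
        mul_le_mul (Real.one_sub_le_exp_neg y) hcosh (Real.cosh_pos y).le (Real.exp_pos _).le
      rw [← Real.exp_add, neg_add_cancel, Real.exp_zero] at hle
      linarith
  · rw [← h0]
    refine antitoneOn_of_deriv_nonpos (convex_Iic 0) hdiff.continuous.continuousOn
      hdiff.differentiableOn (fun y hy => ?_) hx (Set.mem_Iic.2 le_rfl) hx
    rw [interior_Iic, Set.mem_Iio] at hy
    rw [(hderiv y).deriv]
    nlinarith [Real.one_le_cosh y]

lemma exp_mul_le_one_add_add_sq {t M x : ℝ} (ht : 0 ≤ t) (hM : 0 < M) (hx : |x| ≤ M) :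
    Real.exp (t * x) ≤ 1 + t * x + t * Real.sinh (t * M) / M * x ^ 2 := by
  refine (exp_le_one_add_add_mul_sinh (t * x)).trans (add_le_add le_rfl ?_)
  have habs : M * (x * Real.sinh (t * x)) ≤ x ^ 2 * Real.sinh (t * M) := by
    rcases ht.eq_or_lt with rfl | ht
    · simp
    have h := mul_sinh_le_mul_sinh (y := t * |x|) (L := t * M) (by positivity) (by gcongr)
    have h' : M * Real.sinh (t * |x|) ≤ |x| * Real.sinh (t * M) :=
      le_of_mul_le_mul_left (by linarith) ht
    have h'' := mul_le_mul_of_nonneg_left h' (abs_nonneg x)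
    rcases abs_cases x with ⟨hx', -⟩ | ⟨hx', -⟩
    · rw [hx'] at h''
      linarith
    · rw [hx', mul_neg, Real.sinh_neg] at h''
      linarith
  rw [div_mul_eq_mul_div, le_div_iff₀ hM]
  nlinarith [mul_le_mul_of_nonneg_left habs ht]

lemma integrable_exp_mul_of_ae_bound {Ω : Type*} {m0 : MeasurableSpace Ω} {μ : Measure Ω}
    [IsFiniteMeasure μ] {D : Ω → ℝ} {C t : ℝ} (hD : AEStronglyMeasurable D μ)
    (hbdd : ∀ᵐ ω ∂μ, |D ω| ≤ C) :
    Integrable (fun ω => Real.exp (t * D ω)) μ := by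
  refine Integrable.of_bound
    (Real.continuous_exp.comp_aestronglyMeasurable (hD.const_mul t)) (Real.exp (|t| * C)) ?_
  filter_upwards [hbdd] with ω hω
  rw [Real.norm_of_nonneg (Real.exp_pos _).le, Real.exp_le_exp]
  calc t * D ω ≤ |t| * |D ω| := by rw [← abs_mul]; exact le_abs_self _
    _ ≤ |t| * C := by gcongr

lemma condExp_exp_mul_le {Ω : Type*} {m m0 : MeasurableSpace Ω} {μ : Measure Ω}
    [IsProbabilityMeasure μ] (hm : m ≤ m0) {D : Ω → ℝ} {M s t : ℝ} (hM : 0 < M) (ht : 0 ≤ t)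
    (hD : Integrable D μ) (hmean : μ[D|m] =ᵐ[μ] 0) (hbdd : ∀ᵐ ω ∂μ, |D ω| ≤ M)
    (hvar : ∀ᵐ ω ∂μ, (μ[fun ω' => D ω' ^ 2|m]) ω ≤ s) :
    ∀ᵐ ω ∂μ, (μ[fun ω' => Real.exp (t * D ω')|m]) ω ≤
      Real.exp (t * Real.sinh (t * M) / M * s) := by
  set c := t * Real.sinh (t * M) / M
  have hc : 0 ≤ c :=
    div_nonneg (mul_nonneg ht (Real.sinh_nonneg_iff.2 (by positivity))) hM.le
  have hsq : Integrable (fun ω => D ω ^ 2) μ := by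
    refine Integrable.of_bound (hD.aestronglyMeasurable.pow 2) (M ^ 2) ?_
    filter_upwards [hbdd] with ω hω
    rw [norm_pow]
    gcongr
    exact hω
  have hlin : Integrable ((fun _ => (1 : ℝ)) + t • D) μ :=
    (integrable_const 1).add (hD.smul t)
  have hmono : μ[fun ω => Real.exp (t * D ω)|m] ≤ᵐ[μ]
      μ[((fun _ => (1 : ℝ)) + t • D) + c • fun ω => D ω ^ 2|m] := by
    refine condExp_mono (integrable_exp_mul_of_ae_bound hD.aestronglyMeasurable hbdd)
      (hlin.add (hsq.smul c)) ?_
    filter_upwards [hbdd] with ω hω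
    exact exp_mul_le_one_add_add_sq ht hM hω
  filter_upwards [hmono, condExp_add hlin (hsq.smul c) m,
    condExp_add (integrable_const (1 : ℝ)) (hD.smul t) m, condExp_smul t D m,
    condExp_smul c (fun ω => D ω ^ 2) m, hmean, hvar] with ω h1 h2 h3 h4 h5 h6 h7
  rw [h2, Pi.add_apply, h3, Pi.add_apply, h4, h5, condExp_const hm] at h1
  simp only [Pi.smul_apply, h6, Pi.zero_apply, smul_eq_mul, mul_zero, add_zero] at h1
  calc _ ≤ 1 + c * s := h1.trans (by gcongr)
    _ ≤ Real.exp (c * s) := by linarith [Real.add_one_le_exp (c * s)]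

lemma martingale_mgf_le {Ω : Type*} {m0 : MeasurableSpace Ω} {μ : Measure Ω}
    [IsProbabilityMeasure μ] {d : ℕ} {ℱ : Filtration ℕ m0} {Y : ℕ → Ω → ℝ}
    (hadapted : ∀ k ≤ d, StronglyMeasurable[ℱ k] (Y k))
    (hint : ∀ k ≤ d, Integrable (Y k) μ)
    (hmart : ∀ k < d, μ[Y (k + 1)|ℱ k] =ᵐ[μ] Y k)
    {M t : ℝ} (hM : 0 < M) (ht : 0 ≤ t) {s : ℕ → ℝ}
    (hbdd : ∀ k < d, ∀ᵐ ω ∂μ, |Y (k + 1) ω - Y k ω| ≤ M)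
    (hcond : ∀ k < d, ∀ᵐ ω ∂μ,
      (μ[fun ω' => (Y (k + 1) ω' - Y k ω') ^ 2|ℱ k]) ω ≤ s k) :
    ∀ k ≤ d, Integrable (fun ω => Real.exp (t * (Y k ω - Y 0 ω))) μ ∧
      ∫ ω, Real.exp (t * (Y k ω - Y 0 ω)) ∂μ ≤
        Real.exp (t * Real.sinh (t * M) / M * ∑ i ∈ Finset.range k, s i) := by
  have hdiff : ∀ k ≤ d, ∀ᵐ ω ∂μ, |Y k ω - Y 0 ω| ≤ k * M := by
    intro k hk
    induction k with
    | zero => simp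
    | succ k ih =>
      filter_upwards [ih (by lia), hbdd k hk] with ω h1 h2
      push_cast
      linarith [abs_sub_le (Y (k + 1) ω) (Y k ω) (Y 0 ω)]
  have hexp : ∀ k ≤ d, Integrable (fun ω => Real.exp (t * (Y k ω - Y 0 ω))) μ := fun k hk =>
    integrable_exp_mul_of_ae_bound
      ((hint k hk).sub (hint 0 (Nat.zero_le d))).aestronglyMeasurable (hdiff k hk)
  intro k hk
  refine ⟨hexp k hk, ?_⟩
  induction k with
  | zero => simp
  | succ k ih =>
    have hkd : k ≤ d := by lia
    set c := t * Real.sinh (t * M) / M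
    set P : Ω → ℝ := fun ω => Real.exp (t * (Y k ω - Y 0 ω)) with hP
    set D : Ω → ℝ := Y (k + 1) - Y k with hD
    set Q : Ω → ℝ := fun ω => Real.exp (t * D ω) with hQ
    have hDint : Integrable D μ := (hint _ hk).sub (hint _ hkd)
    have hmean : μ[D|ℱ k] =ᵐ[μ] 0 := by
      have h := condExp_of_stronglyMeasurable (ℱ.le k) (hadapted k hkd) (hint k hkd)
      filter_upwards [condExp_sub (hint _ hk) (hint _ hkd) (ℱ k), hmart k hk] with ω h1 h2
      rw [h1, Pi.sub_apply, h2, h, sub_self, Pi.zero_apply]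
    have hQint : Integrable Q μ :=
      integrable_exp_mul_of_ae_bound hDint.aestronglyMeasurable (hbdd k hk)
    have hPQ : (fun ω => Real.exp (t * (Y (k + 1) ω - Y 0 ω))) = P * Q := by
      ext ω
      simp only [hP, hQ, hD, Pi.mul_apply, Pi.sub_apply, ← Real.exp_add]
      ring_nf
    have hPQint : Integrable (P * Q) μ := hPQ ▸ hexp (k + 1) hk
    have hPmeas : StronglyMeasurable[ℱ k] P :=
      Real.continuous_exp.comp_stronglyMeasurable (((hadapted k hkd).sub
        ((hadapted 0 (Nat.zero_le d)).mono (ℱ.mono (Nat.zero_le k)))).const_mul t)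
    rw [hPQ, ← integral_condExp (ℱ.le k), Finset.sum_range_succ, mul_add, Real.exp_add]
    calc ∫ ω, (μ[P * Q|ℱ k]) ω ∂μ ≤ ∫ ω, P ω * Real.exp (c * s k) ∂μ := by
          refine integral_mono_ae integrable_condExp ((hexp k hkd).mul_const _) ?_
          filter_upwards [condExp_mul_of_stronglyMeasurable_left hPmeas hPQint hQint,
            condExp_exp_mul_le (ℱ.le k) hM ht hDint hmean (hbdd k hk) (hcond k hk)] with ω h1 h2
          rw [h1, Pi.mul_apply]
          exact mul_le_mul_of_nonneg_left h2 (Real.exp_pos _).le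
      _ = (∫ ω, P ω ∂μ) * Real.exp (c * s k) := integral_mul_const _ _
      _ ≤ _ := mul_le_mul_of_nonneg_right (ih hkd) (Real.exp_pos _).le

/-- One-sided Prokhorov inequality for real martingales. -/
lemma martingale_real_measure_ge_le {Ω : Type*} {m0 : MeasurableSpace Ω} {μ : Measure Ω}
    [IsProbabilityMeasure μ] {d : ℕ} {ℱ : Filtration ℕ m0} {Y : ℕ → Ω → ℝ}
    (hadapted : ∀ k ≤ d, StronglyMeasurable[ℱ k] (Y k))
    (hint : ∀ k ≤ d, Integrable (Y k) μ)
    (hmart : ∀ k < d, μ[Y (k + 1)|ℱ k] =ᵐ[μ] Y k)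
    {M : ℝ} (hM : 0 < M) {s : ℕ → ℝ} (hs : ∀ k < d, 0 < s k)
    (hbdd : ∀ k < d, ∀ᵐ ω ∂μ, |Y (k + 1) ω - Y k ω| ≤ M)
    (hcond : ∀ k < d, ∀ᵐ ω ∂μ,
      (μ[fun ω' => (Y (k + 1) ω' - Y k ω') ^ 2|ℱ k]) ω ≤ s k)
    {r : ℝ} (hr : 0 ≤ r) :
    μ.real {ω | r ≤ Y d ω - Y 0 ω} ≤
      Real.exp (-(r / (2 * M)) *
        Real.arsinh (M * r / (2 * ∑ k ∈ Finset.range d, s k))) := by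
  set S := ∑ k ∈ Finset.range d, s k with hS
  have hSnonneg : 0 ≤ S := Finset.sum_nonneg fun k hk => (hs k (Finset.mem_range.1 hk)).le
  rcases hSnonneg.eq_or_lt with hS0 | hSpos
  · simp [← hS0, measureReal_le_one]
  set t := Real.arsinh (M * r / (2 * S)) / M with ht
  have ht0 : 0 ≤ t := div_nonneg (Real.arsinh_nonneg_iff.2 (by positivity)) hM.le
  obtain ⟨hexp, hmgf⟩ := martingale_mgf_le hadapted hint hmart hM ht0 hbdd hcond d le_rfl
  refine (ProbabilityTheory.measure_ge_le_exp_mul_mgf r ht0 hexp).trans ?_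
  refine (mul_le_mul_of_nonneg_left hmgf (Real.exp_pos _).le).trans_eq ?_
  rw [← Real.exp_add, ← hS]
  have htM : t * M = Real.arsinh (M * r / (2 * S)) := div_mul_cancel₀ _ hM.ne'
  rw [← htM, show Real.sinh (t * M) = M * r / (2 * S) by rw [htM, Real.sinh_arsinh]]
  congr 1
  field_simp
  ring

/-- One-sided tail bound for a real-linear functional of a complex martingale. -/
lemma martingale_clm_measure_ge_le {Ω : Type*} {m0 : MeasurableSpace Ω} {μ : Measure Ω}
    [IsProbabilityMeasure μ] {d : ℕ} {ℱ : Filtration ℕ m0} {X : ℕ → Ω → ℂ}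
    (hadapted : ∀ k ≤ d, StronglyMeasurable[ℱ k] (X k))
    (hint : ∀ k ≤ d, Integrable (X k) μ)
    (hmart : ∀ k < d, μ[X (k + 1)|ℱ k] =ᵐ[μ] X k)
    {M : ℝ} (hM : 0 < M) {s : ℕ → ℝ} (hs : ∀ k < d, 0 < s k)
    (hbdd : ∀ k < d, ∀ᵐ ω ∂μ, ‖X (k + 1) ω - X k ω‖ ≤ M)
    (hcond : ∀ k < d, ∀ᵐ ω ∂μ,
      (μ[fun ω' => ‖X (k + 1) ω' - X k ω'‖ ^ 2|ℱ k]) ω ≤ s k)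
    {r : ℝ} (hr : 0 ≤ r) (T : ℂ →L[ℝ] ℝ) (hT : ∀ z, |T z| ≤ ‖z‖) :
    μ.real {ω | r ≤ T (X d ω - X 0 ω)} ≤
      Real.exp (-(r / (2 * M)) *
        Real.arsinh (M * r / (2 * ∑ k ∈ Finset.range d, s k))) := by
  have hsq (k : ℕ) (hk : k < d) :
      Integrable (fun ω => ‖X (k + 1) ω - X k ω‖ ^ 2) μ := by
    refine Integrable.of_bound
      (((hint _ hk).sub (hint _ hk.le)).aestronglyMeasurable.norm.pow 2) (M ^ 2) ?_
    filter_upwards [hbdd k hk] with ω hω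
    rw [norm_pow, norm_norm]
    gcongr
  have hTsq (z : ℂ) : T z ^ 2 ≤ ‖z‖ ^ 2 := sq_le_sq' (neg_le_of_abs_le (hT z)) (le_of_abs_le (hT z))
  simp only [map_sub]
  refine martingale_real_measure_ge_le (Y := fun k ω => T (X k ω))
    (fun k hk => T.continuous.comp_stronglyMeasurable (hadapted k hk))
    (fun k hk => T.integrable_comp (hint k hk)) (fun k hk => ?_) hM hs (fun k hk => ?_)
    (fun k hk => ?_) hr
  · filter_upwards [T.comp_condExp_comm (m := ℱ k) (hint (k + 1) hk), hmart k hk] with ω h1 h2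
    rw [← h2]
    exact h1.symm
  · filter_upwards [hbdd k hk] with ω hω
    rw [← map_sub]
    exact (hT _).trans hω
  · simp only [← map_sub]
    have hTint : Integrable (fun ω => T (X (k + 1) ω - X k ω) ^ 2) μ := by
      refine (hsq k hk).mono' ((T.integrable_comp
        ((hint _ hk).sub (hint _ hk.le))).aestronglyMeasurable.pow 2) (ae_of_all _ fun ω => ?_)
      rw [Real.norm_of_nonneg (sq_nonneg _)]
      exact hTsq _
    filter_upwards [condExp_mono (m := ℱ k) hTint (hsq k hk) (ae_of_all _ fun ω => hTsq _),
      hcond k hk] with ω h1 h2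
    exact h1.trans h2

lemma Complex.div_sqrt_two_le_abs_re_or_abs_im {z : ℂ} {ξ : ℝ} (h : ξ ≤ ‖z‖) :
    ξ / √2 ≤ |z.re| ∨ ξ / √2 ≤ |z.im| := by
  rw [← le_max_iff, div_le_iff₀' (by positivity)]
  exact h.trans (Complex.norm_le_sqrt_two_mul_max z)

/-- **Martingale arcsinh (Prokhorov) inequality.**  For a complex-valued martingale
`(X_μ)_{μ=0}^d` with increments bounded by `M` and conditional square function bounded
by `S = Σ s_μ`, one has
`P(|X_d − X_0| ≥ ξ) ≤ 4 exp(−(ξ/(2√2 M)) arcsinh(M ξ/(2√2 S)))`. -/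
theorem martingale_arcsinh_inequality
    {Ω : Type*} [m0 : MeasurableSpace Ω] (μ : Measure Ω) [IsProbabilityMeasure μ]
    (d : ℕ) (ℱ : Filtration ℕ m0) (X : ℕ → Ω → ℂ)
    (hadapted : ∀ k ≤ d, StronglyMeasurable[ℱ k] (X k))
    (hint : ∀ k ≤ d, Integrable (X k) μ)
    (hmart : ∀ k < d, μ[X (k + 1)|ℱ k] =ᵐ[μ] X k)
    (M : ℝ) (hM : 0 < M) (s : ℕ → ℝ) (hs : ∀ k < d, 0 < s k)
    (hbdd : ∀ k < d, ∀ᵐ ω ∂μ, ‖X (k + 1) ω - X k ω‖ ≤ M)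
    (hcond : ∀ k < d, ∀ᵐ ω ∂μ,
      (μ[fun ω' => ‖X (k + 1) ω' - X k ω'‖ ^ 2|ℱ k]) ω ≤ s k)
    (ξ : ℝ) (hξ : 0 < ξ) :
    (μ {ω | ξ ≤ ‖X d ω - X 0 ω‖}).toReal ≤
      4 * Real.exp (-(ξ / (2 * Real.sqrt 2 * M)) *
        Real.arsinh (M * ξ / (2 * Real.sqrt 2 * ∑ k ∈ Finset.range d, s k))) := by
  have key := martingale_clm_measure_ge_le hadapted hint hmart hM hs hbdd hcond
    (r := ξ / √2) (by positivity)
  rw [show ξ / √2 / (2 * M) = ξ / (2 * √2 * M) by rw [div_div]; ring_nf,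
    show M * (ξ / √2) / (2 * ∑ k ∈ Finset.range d, s k) =
      M * ξ / (2 * √2 * ∑ k ∈ Finset.range d, s k) by rw [← mul_div_assoc, div_div]; ring_nf] at key
  have h1 := key Complex.reCLM Complex.abs_re_le_norm
  have h2 := key (-Complex.reCLM) fun z => by simpa using Complex.abs_re_le_norm z
  have h3 := key Complex.imCLM Complex.abs_im_le_norm
  have h4 := key (-Complex.imCLM) fun z => by simpa using Complex.abs_im_le_norm z
  have hsub : {ω | ξ ≤ ‖X d ω - X 0 ω‖} ⊆
      ({ω | ξ / √2 ≤ Complex.reCLM (X d ω - X 0 ω)} ∪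
        {ω | ξ / √2 ≤ (-Complex.reCLM) (X d ω - X 0 ω)}) ∪
      ({ω | ξ / √2 ≤ Complex.imCLM (X d ω - X 0 ω)} ∪
        {ω | ξ / √2 ≤ (-Complex.imCLM) (X d ω - X 0 ω)}) := fun ω hω =>
    (Complex.div_sqrt_two_le_abs_re_or_abs_im hω).imp le_abs.1 le_abs.1
  refine (measureReal_mono hsub).trans ?_
  refine (measureReal_union_le _ _).trans ?_
  refine (add_le_add (measureReal_union_le _ _) (measureReal_union_le _ _)).trans ?_
  linarith

end
end

section
/- Bound on the exceptional stopping time. Let Ω = Θ × U_1 × ⋯ × U_d be a finite probability space whose points are (θ, u_1, …, u_d), such that conditioned on θ the coordinates u_1, …, u_d are independent; let F_μ := σ(θ, u_1, …, u_μ) and G_μ := σ(θ, u_1, …, u_{μ−1}, u_{μ+1}, …, u_d). Let Y_1, …, Y_d be nonnegative random variables with Y_μ being G_μ-measurable, and fix constants γ ≥ 1, K > 0, ζ > 0 and N ≥ 2 with d ≤ N^K. Define the (F_μ)-stopping time τ := min{ μ ∈ {0, …, d−1} : (E[Y_{μ+1}² | F_μ])^{1/2} ≥ 2γ }, with τ :=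 d if this set is empty. Suppose that for all μ ∈ {1,…,d}: P(Y_μ ≥ γ) ≤ e^{−ζ} and Y_μ ≤ N^K almost surely. Then there exists a constant C > 0 (depending only on γ and K) such that P(τ < d) ≤ e^{−ζ + C·log N}. -/
open MeasureTheory

noncomputable section

/-- The sample space `Ω = Θ × U_1 × ⋯ × U_d`. -/
abbrev OmegaSp (d : ℕ) (Θ : Type) (U : Fin d → Type) : Type := Θ × ((μ : Fin d) → U μ)

/-- On the finite sample space, every set is measurable. -/
instance (d : ℕ) (Θ : Type) (U : Fin d → Type) : MeasurableSpace (OmegaSp d Θ U) := ⊤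

/-- The measure on `Ω` with density `w(θ) · ∏_μ p_μ(θ, u_μ)`: conditioned on `θ`,
the coordinates `u_1, …, u_d` are independent. -/
def condProdMeasure {d : ℕ} {Θ : Type} {U : Fin d → Type}
    [Fintype Θ] [∀ μ, Fintype (U μ)]
    (w : Θ → ENNReal) (p : (μ : Fin d) → Θ → U μ → ENNReal) :
    Measure (OmegaSp d Θ U) :=
  ∑ ω : OmegaSp d Θ U, (w ω.1 * ∏ μ, p μ ω.1 (ω.2 μ)) • Measure.dirac ω

/-- `F_k := σ(θ, u_1, …, u_k)`. -/
def Fsig (d : ℕ) (Θ : Type) (U : Fin d → Type) (k : ℕ) :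
    MeasurableSpace (OmegaSp d Θ U) :=
  MeasurableSpace.comap
    (fun ω => (ω.1, fun ν : Fin d =>
      if (ν : ℕ) < k then Option.some (ω.2 ν) else Option.none)) ⊤

/-- `G_μ := σ(θ, u_1, …, u_{μ-1}, u_{μ+1}, …, u_d)`. -/
def Gsig (d : ℕ) (Θ : Type) (U : Fin d → Type) (k : Fin d) :
    MeasurableSpace (OmegaSp d Θ U) :=
  MeasurableSpace.comap
    (fun ω => (ω.1, fun ν : Fin d =>
      if ν = k then Option.none else Option.some (ω.2 ν))) ⊤


/-- The stopping time `τ := min{ μ ∈ {0,…,d−1} : (E[Y_{μ+1}² | F_μ])^{1/2} ≥ 2γ }`,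
with `τ := d` if no such `μ` exists. -/
def tauStop {d : ℕ} {Θ : Type} {U : Fin d → Type}
    (μpr : Measure (OmegaSp d Θ U)) (Y : Fin d → OmegaSp d Θ U → ℝ) (γ : ℝ)
    (ω : OmegaSp d Θ U) : ℕ :=
  sInf {k : ℕ | k = d ∨ ∃ h : k < d,
    2 * γ ≤ Real.sqrt ((μpr[fun ω' => Y ⟨k, h⟩ ω' ^ 2|Fsig d Θ U k]) ω)}

/-- If `0 ≤ Y ≤ M` almost surely and `γ ≥ 1`, the probability that the conditional `L²`-norm of `Y`
is at least `2γ` is at most `M² · P(Y ≥ γ)`. -/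
theorem measureReal_two_mul_le_sqrt_condExp_sq_le {Ω : Type*} {m m0 : MeasurableSpace Ω}
    (hm : m ≤ m0) (μ : Measure Ω) [IsProbabilityMeasure μ] {Y : Ω → ℝ} (hY : Measurable[m0] Y)
    (hY0 : ∀ ω, 0 ≤ Y ω) {γ M : ℝ} (hγ : 1 ≤ γ) (hM : ∀ᵐ ω ∂μ, Y ω ≤ M) :
    μ.real {ω | 2 * γ ≤ Real.sqrt ((μ[fun ω' => Y ω' ^ 2|m]) ω)} ≤
      M ^ 2 * μ.real {ω | γ ≤ Y ω} := by
  set A : Set Ω := {ω | γ ≤ Y ω} with hA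
  have hAm : MeasurableSet A := measurableSet_le measurable_const hY
  set V : Ω → ℝ := A.indicator fun _ => M ^ 2 with hV
  have hV0 : ∀ ω, 0 ≤ V ω := fun ω => Set.indicator_nonneg (fun _ _ => sq_nonneg M) ω
  have hVi : Integrable V μ := (integrable_const _).indicator hAm
  have hYi : Integrable (fun ω => Y ω ^ 2) μ := by
    refine Integrable.of_bound (hY.pow_const 2).aestronglyMeasurable (M ^ 2) ?_
    filter_upwards [hM] with ω hω
    rw [Real.norm_eq_abs, abs_of_nonneg (sq_nonneg _)]
    exact pow_le_pow_left₀ (hY0 ω) hω 2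
  have hle : (fun ω => Y ω ^ 2) ≤ᵐ[μ] (fun _ => γ ^ 2) + V := by
    filter_upwards [hM] with ω hω
    have hsq := pow_le_pow_left₀ (hY0 ω) hω 2
    by_cases h : ω ∈ A
    · simp only [Pi.add_apply, hV, Set.indicator_of_mem h]
      nlinarith [sq_nonneg γ]
    · have hlt : Y ω < γ := not_le.mp h
      simp only [Pi.add_apply, hV, Set.indicator_of_notMem h, add_zero]
      exact pow_le_pow_left₀ (hY0 ω) hlt.le 2
  have hmono := condExp_mono (m := m) hYi ((integrable_const (γ ^ 2)).add hVi) hle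
  have hadd := condExp_add (integrable_const (μ := μ) (γ ^ 2)) hVi m
  have hsub : {ω | 2 * γ ≤ Real.sqrt ((μ[fun ω' => Y ω' ^ 2|m]) ω)} ≤ᵐ[μ]
      {ω | 1 ≤ (μ[V|m]) ω} := by
    filter_upwards [hmono, hadd] with ω h1 h2 (h3 : 2 * γ ≤ _)
    change 1 ≤ _
    rw [h2, Pi.add_apply, condExp_const hm] at h1
    rw [Real.le_sqrt' (by linarith)] at h3
    nlinarith
  have hnn : 0 ≤ᵐ[μ] μ[V|m] := condExp_nonneg (Filter.Eventually.of_forall hV0)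
  have hmarkov := mul_meas_ge_le_integral_of_nonneg hnn integrable_condExp 1
  rw [integral_condExp hm, hV, integral_indicator_const _ hAm, one_mul, smul_eq_mul,
    mul_comm] at hmarkov
  exact (ENNReal.toReal_mono (measure_ne_top _ _) (measure_mono_ae hsub)).trans hmarkov

/-- On `{τ < d}`, some conditional `L²`-norm reaches the threshold `2γ`. -/
theorem setOf_tauStop_lt_subset {d : ℕ} {Θ : Type} {U : Fin d → Type}
    (μpr : Measure (OmegaSp d Θ U)) (Y : Fin d → OmegaSp d Θ U → ℝ) (γ : ℝ) :
    {ω | tauStop μpr Y γ ω < d} ⊆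
      ⋃ k : Fin d, {ω | 2 * γ ≤ Real.sqrt ((μpr[fun ω' => Y k ω' ^ 2|Fsig d Θ U k]) ω)} := by
  intro ω (hω : tauStop μpr Y γ ω < d)
  have hmem : tauStop μpr Y γ ω ∈ {k : ℕ | k = d ∨ ∃ h : k < d,
      2 * γ ≤ Real.sqrt ((μpr[fun ω' => Y ⟨k, h⟩ ω' ^ 2|Fsig d Θ U k]) ω)} :=
    Nat.sInf_mem ⟨d, Or.inl rfl⟩
  obtain h | ⟨h, h'⟩ := hmem
  · exact absurd h hω.ne
  · exact Set.mem_iUnion.mpr ⟨⟨_, h⟩, h'⟩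

/-- **Bound on the exceptional stopping time.** -/
theorem stopping_time_bound (γ K : ℝ) (hγ : 1 ≤ γ) (hK : 0 < K) :
    ∃ C : ℝ, 0 < C ∧
      ∀ (d : ℕ) (Θ : Type) (U : Fin d → Type) [Fintype Θ] [∀ μ, Fintype (U μ)]
        (w : Θ → ENNReal) (p : (μ : Fin d) → Θ → U μ → ENNReal)
        (μpr : Measure (OmegaSp d Θ U)),
        μpr = condProdMeasure w p →
        IsProbabilityMeasure μpr →
        ∀ Y : Fin d → OmegaSp d Θ U → ℝ,
          (∀ μ, Measurable[Gsig d Θ U μ] (Y μ)) →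
          (∀ μ ω, 0 ≤ Y μ ω) →
          ∀ N ζ : ℝ, 2 ≤ N → (d : ℝ) ≤ N ^ K → 0 < ζ →
            (∀ μ, (μpr {ω | γ ≤ Y μ ω}).toReal ≤ Real.exp (-ζ)) →
            (∀ μ, ∀ᵐ ω ∂μpr, Y μ ω ≤ N ^ K) →
            (μpr {ω | tauStop μpr Y γ ω < d}).toReal ≤
              Real.exp (-ζ + C * Real.log N) := by
  refine ⟨3 * K, by positivity, ?_⟩
  intro d Θ U _ _ w p μpr _ _ Y _ hY0 N ζ hN hd _ hP hM
  have hN0 : 0 < N := by linarith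
  calc (μpr {ω | tauStop μpr Y γ ω < d}).toReal
      ≤ μpr.real (⋃ k : Fin d,
          {ω | 2 * γ ≤ Real.sqrt ((μpr[fun ω' => Y k ω' ^ 2|Fsig d Θ U k]) ω)}) :=
        measureReal_mono (setOf_tauStop_lt_subset μpr Y γ)
    _ ≤ ∑ k : Fin d,
          μpr.real {ω | 2 * γ ≤ Real.sqrt ((μpr[fun ω' => Y k ω' ^ 2|Fsig d Θ U k]) ω)} :=
        measureReal_iUnion_fintype_le _
    _ ≤ ∑ _k : Fin d, (N ^ K) ^ 2 * Real.exp (-ζ) := by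
        refine Finset.sum_le_sum fun k _ => ?_
        refine (measureReal_two_mul_le_sqrt_condExp_sq_le le_top μpr measurable_from_top
          (hY0 k) hγ (hM k)).trans ?_
        exact mul_le_mul_of_nonneg_left (hP k) (sq_nonneg _)
    _ = d * ((N ^ K) ^ 2 * Real.exp (-ζ)) := by simp
    _ ≤ N ^ K * ((N ^ K) ^ 2 * Real.exp (-ζ)) :=
        mul_le_mul_of_nonneg_right hd (by positivity)
    _ = Real.exp (-ζ + 3 * K * Real.log N) := by
        rw [Real.rpow_def_of_pos hN0, ← Real.exp_nat_mul, ← Real.exp_add, ← Real.exp_add]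
        congr 1
        push_cast
        ring

end
end

section
/- Increment bounds for the stopped martingale. In the setting of the preceding product-space framework, let X be a complex-valued F_d-measurable random variable and Y_1, …, Y_d nonnegative random variables with Y_μ being G_μ-measurable, satisfying for all μ ∈ {1,…,d}: |X − E[X | G_μ]| ≤ Y_μ almost surely and E[|X − E[X | G_μ]|² | G_μ] ≤ d^{−1}·Y_μ² almost surely. Fix a constant γ ≥ 1, define X_μ := E[X | F_μ], the stopping time τ := min{ μ ∈ {0,…,d−1} : (E[Y_{μ+1}² | F_μ])^{1/2} ≥ 2γ } (τ := d if the set is empty), and X_μ^τ := X_{min(μ,τ)}. Then for all μ ∈ {0,…,d−1}, almost surely: |X_{μ+1}^τ − X_μ^τ| ≤ 2γ and E[|X_{μ+1}^τ − X_μ^τ|² | F_μ] ≤ 4γ²/d. -/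
open MeasureTheory

noncomputable section

/-- The martingale `X_k := E[X | F_k]`. -/
def martX {d : ℕ} {Θ : Type} {U : Fin d → Type}
    (μpr : Measure (OmegaSp d Θ U)) (X : OmegaSp d Θ U → ℂ) (k : ℕ) :
    OmegaSp d Θ U → ℂ :=
  μpr[X|Fsig d Θ U k]

/-- The stopped martingale `X^τ_k(ω) := X_{min(k, τ(ω))}(ω)`. -/
def stoppedMartX {d : ℕ} {Θ : Type} {U : Fin d → Type}
    (μpr : Measure (OmegaSp d Θ U)) (X : OmegaSp d Θ U → ℂ)
    (Y : Fin d → OmegaSp d Θ U → ℝ) (γ : ℝ) (k : ℕ) (ω : OmegaSp d Θ U) : ℂ :=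
  martX μpr X (min k (tauStop μpr Y γ ω)) ω

section CoordinateExchange

variable {d : ℕ} {Θ : Type} {U : Fin d → Type}

instance : DiscreteMeasurableSpace (OmegaSp d Θ U) := ⟨fun _ => trivial⟩

lemma Fsig_le (k : ℕ) : Fsig d Θ U k ≤ instMeasurableSpaceOmegaSp d Θ U := fun _ _ => trivial

lemma Gsig_le (k : Fin d) : Gsig d Θ U k ≤ instMeasurableSpaceOmegaSp d Θ U := fun _ _ => trivial

/-- Two points agree up to level `k` if they share `θ` and the first `k` coordinates. -/
def AgreeUpTo (k : ℕ) (ω ω' : OmegaSp d Θ U) : Prop :=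
  ω.1 = ω'.1 ∧ ∀ ν : Fin d, (ν : ℕ) < k → ω.2 ν = ω'.2 ν

lemma AgreeUpTo.symm {k : ℕ} {ω ω' : OmegaSp d Θ U} (h : AgreeUpTo k ω ω') :
    AgreeUpTo k ω' ω := ⟨h.1.symm, fun ν hν => (h.2 ν hν).symm⟩

lemma AgreeUpTo.trans {k : ℕ} {ω ω' ω'' : OmegaSp d Θ U} (h : AgreeUpTo k ω ω')
    (h' : AgreeUpTo k ω' ω'') : AgreeUpTo k ω ω'' :=
  ⟨h.1.trans h'.1, fun ν hν => (h.2 ν hν).trans (h'.2 ν hν)⟩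

lemma AgreeUpTo.congr_left {k : ℕ} {ω ω' : OmegaSp d Θ U} (h : AgreeUpTo k ω ω')
    (ω'' : OmegaSp d Θ U) : AgreeUpTo k ω ω'' ↔ AgreeUpTo k ω' ω'' :=
  ⟨h.symm.trans, h.trans⟩

lemma Fsig_proj_eq_iff {k : ℕ} {ω ω' : OmegaSp d Θ U} :
    ((ω.1, fun ν : Fin d => if (ν : ℕ) < k then Option.some (ω.2 ν) else Option.none) =
      (ω'.1, fun ν : Fin d => if (ν : ℕ) < k then Option.some (ω'.2 ν) else Option.none)) ↔
      AgreeUpTo k ω ω' := by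
  rw [Prod.mk.injEq, funext_iff]
  refine and_congr Iff.rfl (forall_congr' fun ν => ?_)
  by_cases h : (ν : ℕ) < k <;> simp [h]

lemma measurableSet_Fsig_iff {k : ℕ} {A : Set (OmegaSp d Θ U)} :
    MeasurableSet[Fsig d Θ U k] A ↔ ∀ ω ω', AgreeUpTo k ω ω' → ω ∈ A → ω' ∈ A := by
  constructor
  · rintro ⟨S, -, rfl⟩ ω ω' h hω
    simp only [Set.mem_preimage] at hω ⊢
    rwa [← Fsig_proj_eq_iff.2 h]
  · intro h
    refine ⟨_ '' A, trivial, Set.Subset.antisymm ?_ (Set.subset_preimage_image _ _)⟩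
    rintro ω ⟨ω', hω', he⟩
    exact h ω' ω (Fsig_proj_eq_iff.1 he) hω'

lemma Fsig_mono {j k : ℕ} (h : j ≤ k) : Fsig d Θ U j ≤ Fsig d Θ U k := by
  intro A hA
  rw [measurableSet_Fsig_iff] at hA ⊢
  exact fun ω ω' hω => hA ω ω' ⟨hω.1, fun ν hν => hω.2 ν (hν.trans_le h)⟩

lemma measurableSet_Gsig_of_forall {k : Fin d} {A : Set (OmegaSp d Θ U)}
    (h : ∀ ω ω' : OmegaSp d Θ U, ω.1 = ω'.1 → (∀ ν, ν ≠ k → ω.2 ν = ω'.2 ν) → ω ∈ A → ω' ∈ A) :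
    MeasurableSet[Gsig d Θ U k] A := by
  refine ⟨_ '' A, trivial, Set.Subset.antisymm ?_ (Set.subset_preimage_image _ _)⟩
  rintro ω ⟨ω', hω', he⟩
  rw [Prod.mk.injEq, funext_iff] at he
  refine h ω' ω he.1 (fun ν hν => ?_) hω'
  simpa [hν] using he.2 ν

lemma Fsig_le_Gsig (k : Fin d) : Fsig d Θ U k ≤ Gsig d Θ U k := by
  intro A hA
  rw [measurableSet_Fsig_iff] at hA
  refine measurableSet_Gsig_of_forall fun ω ω' h1 h2 => hA ω ω' ⟨h1, fun ν hν => h2 ν ?_⟩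
  rintro rfl
  exact lt_irrefl _ hν

lemma apply_update_eq_of_measurable_Gsig {E : Type*} [MeasurableSpace E]
    [MeasurableSingletonClass E] {k : Fin d} {Z : OmegaSp d Θ U → E}
    (hZ : Measurable[Gsig d Θ U k] Z) (ω : OmegaSp d Θ U) (x : U k) :
    Z (ω.1, Function.update ω.2 k x) = Z ω := by
  obtain ⟨S, -, hS⟩ := hZ (measurableSet_singleton (Z ω))
  have h : ω ∈ Z ⁻¹' {Z ω} := rfl
  change (ω.1, Function.update ω.2 k x) ∈ Z ⁻¹' {Z ω}
  rw [← hS, Set.mem_preimage] at h ⊢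
  convert h using 3 with ν
  by_cases hν : ν = k
  · simp [hν]
  · simp [hν]

/-- Exchange the `k`-th coordinates of a pair of points. -/
def swapCoord (k : Fin d) (q : OmegaSp d Θ U × OmegaSp d Θ U) :
    OmegaSp d Θ U × OmegaSp d Θ U :=
  ((q.1.1, Function.update q.1.2 k (q.2.2 k)), (q.2.1, Function.update q.2.2 k (q.1.2 k)))

lemma swapCoord_involutive (k : Fin d) :
    Function.Involutive (swapCoord k : OmegaSp d Θ U × OmegaSp d Θ U → _) := by
  intro q
  simp [swapCoord]

lemma agreeUpTo_update (k : Fin d) (ω : OmegaSp d Θ U) (x : U k) :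
    AgreeUpTo (k : ℕ) ω (ω.1, Function.update ω.2 k x) := by
  refine ⟨rfl, fun ν hν => ?_⟩
  have : ν ≠ k := by rintro rfl; exact lt_irrefl _ hν
  simp [this]

lemma AgreeUpTo.succ_update {k : Fin d} {ω ω' : OmegaSp d Θ U} (h : AgreeUpTo (k : ℕ) ω ω') :
    AgreeUpTo (k + 1 : ℕ) ω (ω'.1, Function.update ω'.2 k (ω.2 k)) := by
  refine ⟨h.1, fun ν hν => ?_⟩
  by_cases hk : ν = k
  · subst hk; simp
  · have : (ν : ℕ) ≠ k := fun h' => hk (Fin.ext h')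
    simpa [hk] using h.2 ν (by omega)

variable [Fintype Θ] [∀ μ, Fintype (U μ)]

lemma condProdMeasure_singleton (w : Θ → ENNReal) (p : (μ : Fin d) → Θ → U μ → ENNReal)
    (ω : OmegaSp d Θ U) :
    condProdMeasure w p {ω} = w ω.1 * ∏ μ, p μ ω.1 (ω.2 μ) := by
  classical
  rw [condProdMeasure, Measure.finsetSum_apply, Finset.sum_eq_single ω]
  · simp
  · intro b _ hb
    simp [hb]
  · simp

lemma condProdMeasure_real_swapCoord (w : Θ → ENNReal) (p : (μ : Fin d) → Θ → U μ → ENNReal)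
    (k : Fin d) (q : OmegaSp d Θ U × OmegaSp d Θ U) (hq : q.1.1 = q.2.1) :
    (condProdMeasure w p).real {(swapCoord k q).1} * (condProdMeasure w p).real {(swapCoord k q).2}
      = (condProdMeasure w p).real {q.1} * (condProdMeasure w p).real {q.2} := by
  simp only [Measure.real, ← ENNReal.toReal_mul, condProdMeasure_singleton, swapCoord]
  congr 1
  rw [mul_mul_mul_comm, mul_mul_mul_comm (w q.1.1) (∏ μ, p μ q.1.1 (q.1.2 μ)),
    ← Finset.prod_mul_distrib, ← Finset.prod_mul_distrib]
  congr 1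
  refine Finset.prod_congr rfl fun ν _ => ?_
  by_cases hν : ν = k
  · subst hν
    simp [hq, mul_comm]
  · simp [hν]

variable {E : Type*} [NormedAddCommGroup E] [NormedSpace ℝ E]

open Classical in
/-- The mass of the atom of `Fsig d Θ U k` containing `ω`. -/
def atomMass (μpr : Measure (OmegaSp d Θ U)) (k : ℕ) (ω : OmegaSp d Θ U) : ℝ :=
  ∑ ω', if AgreeUpTo k ω ω' then μpr.real {ω'} else 0

open Classical in
/-- The average of `Z` over the atom of `Fsig d Θ U k` containing `ω`. -/
def atomAverage (μpr : Measure (OmegaSp d Θ U)) (k : ℕ) (Z : OmegaSp d Θ U → E)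
    (ω : OmegaSp d Θ U) : E :=
  (atomMass μpr k ω)⁻¹ • ∑ ω', if AgreeUpTo k ω ω' then μpr.real {ω'} • Z ω' else 0

lemma atomMass_congr (μpr : Measure (OmegaSp d Θ U)) {k : ℕ} {ω ω' : OmegaSp d Θ U}
    (h : AgreeUpTo k ω ω') : atomMass μpr k ω = atomMass μpr k ω' := by
  classical
  unfold atomMass
  exact Finset.sum_congr rfl fun ω'' _ => if_congr (h.congr_left ω'') rfl rfl

lemma atomAverage_congr (μpr : Measure (OmegaSp d Θ U)) {k : ℕ} (Z : OmegaSp d Θ U → E)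
    {ω ω' : OmegaSp d Θ U} (h : AgreeUpTo k ω ω') :
    atomAverage μpr k Z ω = atomAverage μpr k Z ω' := by
  classical
  unfold atomAverage
  rw [atomMass_congr μpr h]
  exact congrArg _ (Finset.sum_congr rfl fun ω'' _ => if_congr (h.congr_left ω'') rfl rfl)

lemma real_singleton_mul_atomMass_div (μpr : Measure (OmegaSp d Θ U)) (k : ℕ)
    (ω : OmegaSp d Θ U) :
    μpr.real {ω} * atomMass μpr k ω * (atomMass μpr k ω)⁻¹ = μpr.real {ω} := by
  classical
  by_cases h : atomMass μpr k ω = 0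
  · have h0 := h
    rw [atomMass, Finset.sum_eq_zero_iff_of_nonneg
      (fun _ _ => by split_ifs <;> simp)] at h0
    have h1 := h0 ω (Finset.mem_univ _)
    rw [if_pos ⟨rfl, fun _ _ => rfl⟩] at h1
    simp [h1]
  · rw [mul_assoc, mul_inv_cancel₀ h, mul_one]

lemma setIntegral_atomAverage {w : Θ → ENNReal} {p : (μ : Fin d) → Θ → U μ → ENNReal}
    {μpr : Measure (OmegaSp d Θ U)} (hμ : μpr = condProdMeasure w p) [IsFiniteMeasure μpr]
    [CompleteSpace E] [MeasurableSpace E] [MeasurableSingletonClass E]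
    {k : Fin d} {Z : OmegaSp d Θ U → E} (hZ : Measurable[Gsig d Θ U k] Z)
    {A : Set (OmegaSp d Θ U)} (hA : MeasurableSet[Fsig d Θ U (k + 1)] A) :
    ∫ ω in A, atomAverage μpr k Z ω ∂μpr = ∫ ω in A, Z ω ∂μpr := by
  classical
  rw [measurableSet_Fsig_iff] at hA
  rw [← integral_indicator .of_discrete, ← integral_indicator .of_discrete,
    integral_fintype .of_finite, integral_fintype .of_finite]
  let c : OmegaSp d Θ U × OmegaSp d Θ U → E := fun q =>
    (μpr.real {q.1} * μpr.real {q.2} * (atomMass μpr k q.1)⁻¹) • Z q.1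
  have hR : ∑ ω, μpr.real {ω} • A.indicator Z ω =
      ∑ q, if AgreeUpTo k q.1 q.2 ∧ q.1 ∈ A then c q else 0 := by
    refine Eq.trans ?_ (Fintype.sum_prod_type _).symm
    refine Finset.sum_congr rfl fun ω _ => ?_
    by_cases hω : ω ∈ A
    · simp only [hω, and_true, Set.indicator_of_mem, c]
      conv_lhs => rw [← real_singleton_mul_atomMass_div μpr k ω]
      rw [atomMass, Finset.mul_sum, Finset.sum_mul, Finset.sum_smul]
      refine Finset.sum_congr rfl fun ω' _ => ?_
      split_ifs <;> simp
    · simp [hω]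
  have hL : ∑ ω, μpr.real {ω} • A.indicator (atomAverage μpr k Z) ω =
      ∑ q, if AgreeUpTo k q.1 q.2 ∧ q.2 ∈ A then c q else 0 := by
    refine Eq.trans ?_ (Fintype.sum_prod_type_right _).symm
    refine Finset.sum_congr rfl fun ω _ => ?_
    by_cases hω : ω ∈ A
    · simp only [hω, and_true, Set.indicator_of_mem, c, atomAverage, Finset.smul_sum]
      refine Finset.sum_congr rfl fun ω' _ => ?_
      by_cases h : AgreeUpTo k ω ω'
      · rw [if_pos h, if_pos h.symm, smul_smul, smul_smul, atomMass_congr μpr h]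
        congr 1
        ring
      · rw [if_neg h, if_neg fun h' => h h'.symm]
        simp
    · simp [hω]
  rw [hL, hR, ← Equiv.sum_comp (swapCoord_involutive k).toPerm]
  refine Finset.sum_congr rfl fun q _ => ?_
  simp only [Function.Involutive.coe_toPerm]
  have h1 : AgreeUpTo k q.1 (swapCoord k q).1 := agreeUpTo_update k _ _
  have h2 : AgreeUpTo k q.2 (swapCoord k q).2 := agreeUpTo_update k _ _
  by_cases h : AgreeUpTo k q.1 q.2
  · have h3 : AgreeUpTo (k + 1) q.1 (swapCoord k q).2 := h.succ_update
    have h4 : AgreeUpTo k (swapCoord k q).1 (swapCoord k q).2 := h1.symm.trans (h.trans h2)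
    have h5 : (swapCoord k q).2 ∈ A ↔ q.1 ∈ A := ⟨hA _ _ h3.symm, hA _ _ h3⟩
    have h6 : c (swapCoord k q) = c q := by
      simp only [c]
      rw [← atomMass_congr μpr h1, hμ, condProdMeasure_real_swapCoord w p k q h.1]
      congr 1
      exact apply_update_eq_of_measurable_Gsig hZ q.1 _
    simp only [h, h4, h5, h6]
  · have h4 : ¬ AgreeUpTo k (swapCoord k q).1 (swapCoord k q).2 :=
      fun h' => h (h1.trans (h'.trans h2.symm))
    simp [h, h4]

/-- Conditioning a function that does not involve the `k`-th coordinate on `Fsig (k + 1)` is the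
same as conditioning it on `Fsig k`. -/
lemma condExp_Fsig_succ_of_measurable_Gsig [CompleteSpace E] [MeasurableSpace E] [BorelSpace E]
    [SecondCountableTopology E] {w : Θ → ENNReal} {p : (μ : Fin d) → Θ → U μ → ENNReal}
    {μpr : Measure (OmegaSp d Θ U)} (hμ : μpr = condProdMeasure w p) [IsFiniteMeasure μpr]
    {k : Fin d} {Z : OmegaSp d Θ U → E} (hZ : Measurable[Gsig d Θ U k] Z) :
    μpr[Z|Fsig d Θ U (k + 1)] =ᵐ[μpr] μpr[Z|Fsig d Θ U k] := by
  have hm : StronglyMeasurable[Fsig d Θ U k] (atomAverage μpr k Z) := by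
    refine Measurable.stronglyMeasurable fun S _ => ?_
    rw [measurableSet_Fsig_iff]
    intro ω ω' h hω
    rwa [Set.mem_preimage, ← atomAverage_congr μpr Z h]
  have hle : Fsig d Θ U k ≤ Fsig d Θ U (k + 1) := Fsig_mono (Nat.le_succ _)
  refine (ae_eq_condExp_of_forall_setIntegral_eq (Fsig_le _) .of_finite
    (fun _ _ _ => Integrable.of_finite.integrableOn)
    (fun A hA _ => setIntegral_atomAverage hμ hZ hA)
    (hm.mono hle).aestronglyMeasurable).symm.trans
    (ae_eq_condExp_of_forall_setIntegral_eq (Fsig_le _) .of_finite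
    (fun _ _ _ => Integrable.of_finite.integrableOn)
    (fun A hA _ => setIntegral_atomAverage hμ hZ (hle A hA))
    hm.aestronglyMeasurable)

end CoordinateExchange

section Increments

variable {d : ℕ} {Θ : Type} {U : Fin d → Type} (μpr : Measure (OmegaSp d Θ U))

lemma lt_tauStop_iff (Y : Fin d → OmegaSp d Θ U → ℝ) (γ : ℝ) (k : Fin d) (ω : OmegaSp d Θ U) :
    (k : ℕ) < tauStop μpr Y γ ω ↔ ∀ j : Fin d, j ≤ k →
      Real.sqrt ((μpr[fun ω' => Y j ω' ^ 2|Fsig d Θ U j]) ω) < 2 * γ := by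
  constructor
  · intro h j hj
    by_contra! hc
    exact (Nat.sInf_le (Or.inr ⟨j.2, hc⟩ : (j : ℕ) ∈ {k : ℕ | k = d ∨ ∃ h : k < d,
      2 * γ ≤ Real.sqrt ((μpr[fun ω' => Y ⟨k, h⟩ ω' ^ 2|Fsig d Θ U k]) ω)})).not_gt
      (lt_of_le_of_lt (Fin.le_def.1 hj) h)
  · intro h
    by_contra! hc
    have hmem : tauStop μpr Y γ ω ∈ {k : ℕ | k = d ∨ ∃ h : k < d,
      2 * γ ≤ Real.sqrt ((μpr[fun ω' => Y ⟨k, h⟩ ω' ^ 2|Fsig d Θ U k]) ω)} :=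
      Nat.sInf_mem ⟨d, Or.inl rfl⟩
    rcases hmem with h' | ⟨h', hle⟩
    · exact absurd k.2 (by omega)
    · exact (h ⟨_, h'⟩ hc).not_ge hle

lemma measurableSet_lt_tauStop (Y : Fin d → OmegaSp d Θ U → ℝ) (γ : ℝ) (k : Fin d) :
    MeasurableSet[Fsig d Θ U k] {ω | (k : ℕ) < tauStop μpr Y γ ω} := by
  simp only [lt_tauStop_iff, Set.ofPred_forall]
  refine MeasurableSet.iInter fun j => MeasurableSet.iInter fun hj => ?_
  refine Fsig_mono (Fin.le_def.1 hj) _ ?_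
  exact measurableSet_lt (Real.continuous_sqrt.measurable.comp
    stronglyMeasurable_condExp.measurable) measurable_const

lemma stoppedMartX_succ_sub (X : OmegaSp d Θ U → ℂ) (Y : Fin d → OmegaSp d Θ U → ℝ) (γ : ℝ)
    (k : ℕ) (ω : OmegaSp d Θ U) :
    stoppedMartX μpr X Y γ (k + 1) ω - stoppedMartX μpr X Y γ k ω =
      {ω | k < tauStop μpr Y γ ω}.indicator
        (fun ω => martX μpr X (k + 1) ω - martX μpr X k ω) ω := by
  by_cases h : k < tauStop μpr Y γ ω
  · simp [stoppedMartX, h, min_eq_left h.le]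
  · have hn : ω ∉ {ω | k < tauStop μpr Y γ ω} := h
    rw [Set.indicator_of_notMem hn, stoppedMartX, stoppedMartX, min_eq_right (by omega),
      min_eq_right (by omega), sub_self]

end Increments

/-- **Increment bounds for the stopped martingale.** -/
theorem stopped_martingale_increments
    (γ : ℝ) (hγ : 1 ≤ γ)
    (d : ℕ) (Θ : Type) (U : Fin d → Type) [Fintype Θ] [∀ μ, Fintype (U μ)]
    (w : Θ → ENNReal) (p : (μ : Fin d) → Θ → U μ → ENNReal)
    (μpr : Measure (OmegaSp d Θ U))
    (hμ : μpr = condProdMeasure w p)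
    (hprob : IsProbabilityMeasure μpr)
    (X : OmegaSp d Θ U → ℂ) (Y : Fin d → OmegaSp d Θ U → ℝ)
    (hX : Measurable[Fsig d Θ U d] X)
    (hY : ∀ μ, Measurable[Gsig d Θ U μ] (Y μ))
    (hY0 : ∀ μ ω, 0 ≤ Y μ ω)
    (h1 : ∀ μ, ∀ᵐ ω ∂μpr, ‖X ω - (μpr[X|Gsig d Θ U μ]) ω‖ ≤ Y μ ω)
    (h2 : ∀ μ, ∀ᵐ ω ∂μpr,
      (μpr[fun ω' => ‖X ω' - (μpr[X|Gsig d Θ U μ]) ω'‖ ^ 2|Gsig d Θ U μ]) ω ≤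
        (d : ℝ)⁻¹ * Y μ ω ^ 2) :
    ∀ k : ℕ, k < d →
      (∀ᵐ ω ∂μpr,
        ‖stoppedMartX μpr X Y γ (k + 1) ω - stoppedMartX μpr X Y γ k ω‖ ≤ 2 * γ) ∧
      (∀ᵐ ω ∂μpr,
        (μpr[fun ω' => ‖stoppedMartX μpr X Y γ (k + 1) ω' -
            stoppedMartX μpr X Y γ k ω'‖ ^ 2|Fsig d Θ U k]) ω ≤ 4 * γ ^ 2 / d) := by
  intro k hk
  have key := fun (Z : OmegaSp d Θ U → ℂ) hZ =>
    condExp_Fsig_succ_of_measurable_Gsig (k := ⟨k, hk⟩) (Z := Z) hμ hZ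
  have keyR := fun (Z : OmegaSp d Θ U → ℝ) hZ =>
    condExp_Fsig_succ_of_measurable_Gsig (k := ⟨k, hk⟩) (Z := Z) hμ hZ
  have hFG : Fsig d Θ U k ≤ Gsig d Θ U ⟨k, hk⟩ := Fsig_le_Gsig ⟨k, hk⟩
  have hFF : Fsig d Θ U k ≤ Fsig d Θ U (k + 1) := Fsig_mono k.le_succ
  have hint : ∀ f : OmegaSp d Θ U → ℝ, Integrable f μpr := fun _ => .of_finite
  have hintC : ∀ f : OmegaSp d Θ U → ℂ, Integrable f μpr := fun _ => .of_finite
  set y := Y ⟨k, hk⟩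
  set D : OmegaSp d Θ U → ℂ := X - μpr[X|Gsig d Θ U ⟨k, hk⟩]
  set S : Set (OmegaSp d Θ U) := {ω | k < tauStop μpr Y γ ω}
  have hSm : MeasurableSet[Fsig d Θ U k] S := measurableSet_lt_tauStop μpr Y γ ⟨k, hk⟩
  -- the increment is the conditional expectation of `D`
  have hinc : (fun ω => martX μpr X (k + 1) ω - martX μpr X k ω) =ᵐ[μpr]
      μpr[D|Fsig d Θ U (k + 1)] := by
    filter_upwards [condExp_sub (hintC X) (hintC (μpr[X|Gsig d Θ U ⟨k, hk⟩])) (Fsig d Θ U (k + 1)),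
      key _ stronglyMeasurable_condExp.measurable,
      condExp_condExp_of_le (f := X) (μ := μpr) hFG (Gsig_le _)] with ω e1 e2 e3
    rw [e1, Pi.sub_apply, e2, e3, martX, martX]
  have hvar : ∀ ω ∈ S, (μpr[fun ω' => y ω' ^ 2|Fsig d Θ U k]) ω ≤ (2 * γ) ^ 2 := by
    intro ω hω
    have := (lt_tauStop_iff μpr Y γ ⟨k, hk⟩ ω).1 hω ⟨k, hk⟩ le_rfl
    exact (Real.sqrt_le_left (by linarith)).1 this.le
  have hDy : μpr[fun ω => (‖D ω‖)|Fsig d Θ U (k + 1)] ≤ᵐ[μpr] μpr[y|Fsig d Θ U (k + 1)] :=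
    condExp_mono (hint _) (hint _) (h1 ⟨k, hk⟩)
  have hD2 : μpr[fun ω => ‖D ω‖ ^ 2|Fsig d Θ U k] ≤ᵐ[μpr]
      μpr[fun ω => (d : ℝ)⁻¹ * y ω ^ 2|Fsig d Θ U k] :=
    (condExp_condExp_of_le hFG (Gsig_le _)).symm.le.trans
      (condExp_mono (hint _) (hint _) (h2 ⟨k, hk⟩))
  have hsq : ∀ (m : MeasurableSpace (OmegaSp d Θ U)) (f : OmegaSp d Θ U → ℂ),
      (fun ω => ‖(μpr[f|m]) ω‖ ^ 2) ≤ᵐ[μpr] μpr[fun ω => ‖f ω‖ ^ 2|m] := by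
    intro m f
    simpa using Integrable.norm_condExp_rpow_le (f := f) (m := m) (p := 2) one_le_two (hint _)
  have hsqR : (fun ω => ‖(μpr[y|Fsig d Θ U k]) ω‖ ^ 2) ≤ᵐ[μpr]
      μpr[fun ω => y ω ^ 2|Fsig d Θ U k] := by
    simpa using Integrable.norm_condExp_rpow_le (f := y) (m := Fsig d Θ U k) (p := 2) one_le_two
      (hint _)
  simp only [stoppedMartX_succ_sub]
  constructor
  · filter_upwards [hinc, norm_condExp_le (μ := μpr) (m := Fsig d Θ U (k + 1)) D, hDy,
      keyR y (hY _), hsqR] with ω e1 e2 e3 e4 e5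
    by_cases hω : ω ∈ S
    · rw [Set.indicator_of_mem hω, e1]
      refine (e2.trans e3).trans ?_
      rw [e4]
      exact (le_abs_self _).trans (abs_le_of_sq_le_sq' (by
        simpa using e5.trans (hvar ω hω)) (by linarith) |> abs_le.2)
    · rw [Set.indicator_of_notMem hω, norm_zero]
      linarith
  · have e : (fun ω => ‖S.indicator
        (fun ω => martX μpr X (k + 1) ω - martX μpr X k ω) ω‖ ^ 2) =
        S.indicator (fun ω => ‖martX μpr X (k + 1) ω - martX μpr X k ω‖ ^ 2) := by
      ext ω
      by_cases hω : ω ∈ S <;> simp [hω]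
    rw [e]
    have hle : μpr[fun ω => ‖martX μpr X (k + 1) ω - martX μpr X k ω‖ ^ 2|Fsig d Θ U k] ≤ᵐ[μpr]
        μpr[fun ω => ‖D ω‖ ^ 2|Fsig d Θ U k] := by
      refine (condExp_mono (hint _) (hint _) ?_).trans
        (condExp_condExp_of_le hFF (Fsig_le _)).le
      filter_upwards [hinc, hsq (Fsig d Θ U (k + 1)) D] with ω e1 e2
      rw [e1]
      exact e2
    filter_upwards [condExp_indicator (hint _) hSm, hle, hD2,
      condExp_smul (μ := μpr) (d : ℝ)⁻¹ (fun ω => y ω ^ 2) (Fsig d Θ U k)] with ω e1 e2 e3 e4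
    rw [e1]
    by_cases hω : ω ∈ S
    · rw [Set.indicator_of_mem hω]
      refine (e2.trans e3).trans ?_
      refine e4.trans_le ?_
      rw [Pi.smul_apply, smul_eq_mul, div_eq_inv_mul]
      exact mul_le_mul_of_nonneg_left ((hvar ω hω).trans_eq (by ring)) (by positivity)
    · rw [Set.indicator_of_notMem hω]
      positivity

end
end
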